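/- Assume the vertex set {1,…,N} is partitioned into {s} and pairwise disjoint nonempty sets 𝒲_1, …, 𝒲_r with r > 1, where s is a source (W_{sk} = 0 for all k) and W_{jk} = 0 whenever j and k lie in distinct subgraphs. Let G_η be the symmetry vector field (G_η)_j = F_j − ω_s for j ∈ 𝒲_η and 0 otherwise. Suppose three pairwise distinct vertices u, v, w ≠ s satisfy: (B1) each x ∈ {u,v,w} has a unique incoming edge, coming from s, with identical weight and phase lag: W_{xk} = 0 for all k ≠ s, and the complex weight 𝒜_s := (σ/2) W_{xs} e^{−iα_{xs}} takes the same nonzero value for all x ∈ {u,v,w}; (B2) ω_u = ω_v = ω_w = ω_s − 2 Im(𝒜_s); (B3) the set {u,v,w} ∩ 𝒲_η has exactly 1 or 2 elements. Then: (i) Σ_j F_j(θ) ∂C_{suvw}/∂θ_j(θ) = 0 wherever C_{suvw} is defined; (ii) the function h(θ) := Σ_j (G_η)_j(θ) ∂C_{suvw}/∂θ_j(θ) satisfies Σ_j F_j(θ) ∂h/∂θ_j(θ) = 0 wherever defined; and (iii) there exists θ at which the Jacobian of the map θ ↦ (C_{suvw}(θ), h(θ)) has rank 2, so C_{suvw}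 and h are functionally independent constants of motion. -/

import Mathlib

/-- The Kuramoto vector field. -/
noncomputable def kuramotoF {N : ℕ} (W α : Fin N → Fin N → ℝ) (ω : Fin N → ℝ) (σ : ℝ)
    (θ : Fin N → ℝ) : Fin N → ℝ :=
  fun j => ω j + σ * ∑ k, W j k * Real.sin (θ k - θ j - α j k)

/-- The restriction of the Kuramoto field to a subgraph `S`, in the rotating frame of a source
with natural frequency `ωs`. -/
noncomputable def kuramotoG {N : ℕ} (W α : Fin N → Fin N → ℝ) (ω : Fin N → ℝ) (σ : ℝ)
    (S : Finset (Fin N)) (ωs : ℝ) (θ : Fin N → ℝ) : Fin N → ℝ :=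
  fun j => if j ∈ S then kuramotoF W α ω σ θ j - ωs else 0

/-- The phase cross-ratio of four oscillators. -/
noncomputable def crossRatioTheta {N : ℕ} (a b c d : Fin N) (θ : Fin N → ℝ) : ℝ :=
  (Real.sin ((θ c - θ a) / 2) * Real.sin ((θ d - θ b) / 2)) /
    (Real.sin ((θ c - θ b) / 2) * Real.sin ((θ d - θ a) / 2))

section HalfAngles

open Real

/-- Derivative of the cross-ratio of the source and three further phases along the field
`-4 sin x (p cos x + q sin x)`, where `A`, `B`, `C` are the half-phases relative to the source and
the weights `eu`, `ev`, `ew` scale the contribution of each phase. -/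
noncomputable def weightedCrossRatioDeriv (p q eu ev ew A B C : ℝ) : ℝ :=
  2 * sin A * sin B / (sin C * sin (B - A) ^ 2) *
    (ev * sin (C - A) * (p * cos B + q * sin B) - eu * sin (C - B) * (p * cos A + q * sin A)
      - ew * sin (B - A) * (p * cos C + q * sin C))

theorem weightedCrossRatioDeriv_one (p q A B C : ℝ) :
    weightedCrossRatioDeriv p q 1 1 1 A B C = 0 := by
  unfold weightedCrossRatioDeriv
  refine mul_eq_zero_of_right _ ?_
  simp only [sin_sub]
  ring

/-- Along a flow of the same projective form with parameters `a`, `b`, the numerators in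
`weightedCrossRatioDeriv` change only through the determinant `p * b - q * a`. -/
theorem hasDerivAt_weightedCrossRatioDeriv (p q eu ev ew a b t : ℝ) {A B C : ℝ → ℝ}
    (hA : HasDerivAt A (-2 * sin (A t) * (a * cos (A t) + b * sin (A t))) t)
    (hB : HasDerivAt B (-2 * sin (B t) * (a * cos (B t) + b * sin (B t))) t)
    (hC : HasDerivAt C (-2 * sin (C t) * (a * cos (C t) + b * sin (C t))) t)
    (hD : sin (B t - A t) ≠ 0) (hs : sin (C t) ≠ 0) :
    HasDerivAt (fun τ => weightedCrossRatioDeriv p q eu ev ew (A τ) (B τ) (C τ))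
      (4 * (p * b - q * a) * sin (A t) * sin (B t) / (sin (C t) * sin (B t - A t) ^ 2) *
        (ev * sin (B t) * sin (C t - A t) - eu * sin (A t) * sin (C t - B t)
          - ew * sin (C t) * sin (B t - A t))) t := by
  have sin_deriv : ∀ {X : ℝ → ℝ},
      HasDerivAt X (-2 * sin (X t) * (a * cos (X t) + b * sin (X t))) t →
      HasDerivAt (fun τ => sin (X τ))
        ((-2 * a - 2 * sin (X t) * (b * cos (X t) - a * sin (X t))) * sin (X t)) t := by
    intro X hX
    refine hX.sin.congr_deriv ?_
    linear_combination (-2 * a * sin (X t)) * sin_sq_add_cos_sq (X t)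
  have form_deriv : ∀ {X : ℝ → ℝ},
      HasDerivAt X (-2 * sin (X t) * (a * cos (X t) + b * sin (X t))) t →
      HasDerivAt (fun τ => p * cos (X τ) + q * sin (X τ))
        ((-2 * sin (X t) * (b * cos (X t) - a * sin (X t))) * (p * cos (X t) + q * sin (X t))
          + 2 * (p * b - q * a) * sin (X t)) t := by
    intro X hX
    refine ((hX.cos.const_mul p).add (hX.sin.const_mul q)).congr_deriv ?_
    linear_combination (2 * (p * b - q * a) * sin (X t)) * sin_sq_add_cos_sq (X t)
  have diff_deriv : ∀ {X Y : ℝ → ℝ},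
      HasDerivAt X (-2 * sin (X t) * (a * cos (X t) + b * sin (X t))) t →
      HasDerivAt Y (-2 * sin (Y t) * (a * cos (Y t) + b * sin (Y t))) t →
      HasDerivAt (fun τ => sin (Y τ - X τ))
        ((-2 * a - 2 * sin (X t) * (b * cos (X t) - a * sin (X t))
          - 2 * sin (Y t) * (b * cos (Y t) - a * sin (Y t))) * sin (Y t - X t)) t := by
    intro X Y hX hY
    refine (hY.sub hX).sin.congr_deriv ?_
    simp only [Pi.sub_apply, sin_sub, cos_sub]
    have h1 := sin_sq_add_cos_sq (X t)
    have h2 := sin_sq_add_cos_sq (Y t)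
    generalize sin (X t) = x, cos (X t) = x', sin (Y t) = y, cos (Y t) = y' at h1 h2 ⊢
    clear * - h1 h2
    grind
  have h := ((((sin_deriv hA).const_mul 2).mul (sin_deriv hB)).div
    ((sin_deriv hC).mul ((diff_deriv hA hB).pow 2)) 
      (mul_ne_zero hs (pow_ne_zero 2 hD))).mul
    (((((diff_deriv hA hC).const_mul ev).mul (form_deriv hB)).sub
      (((diff_deriv hB hC).const_mul eu).mul (form_deriv hA))).sub
      (((diff_deriv hA hB).const_mul ew).mul (form_deriv hC)))
  refine (h.congr_deriv ?_)
  simp only [Pi.mul_apply, Pi.sub_apply, Pi.div_apply, Pi.pow_apply]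
  generalize sin (B t - A t) = D at *
  generalize sin (C t - A t) = E at *
  generalize sin (C t - B t) = G at *
  field_simp
  push_cast
  ring

end HalfAngles

open Real in
theorem fderiv_crossRatioTheta_apply {N : ℕ} (s u v w : Fin N) (θ δ : Fin N → ℝ)
    (h : sin ((θ v - θ u) / 2) * sin ((θ w - θ s) / 2) ≠ 0) :
    fderiv ℝ (crossRatioTheta s u v w) θ δ =
      sin ((θ v - θ s) / 2) * sin ((θ w - θ v) / 2) /
          (2 * sin ((θ w - θ s) / 2) * sin ((θ v - θ u) / 2) ^ 2) * (δ u - δ s)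
        - sin ((θ w - θ u) / 2) * sin ((θ u - θ s) / 2) /
          (2 * sin ((θ w - θ s) / 2) * sin ((θ v - θ u) / 2) ^ 2) * (δ v - δ s)
        + sin ((θ u - θ s) / 2) * sin ((θ v - θ s) / 2) /
          (2 * sin ((θ v - θ u) / 2) * sin ((θ w - θ s) / 2) ^ 2) * (δ w - δ s) := by
  have hdiff : DifferentiableAt ℝ (crossRatioTheta s u v w) θ := by
    unfold crossRatioTheta
    fun_prop (disch := assumption)
  have hsin : ∀ x y : Fin N, HasDerivAt (fun τ : ℝ => sin (((θ + τ • δ) x - (θ + τ • δ) y) / 2))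
      (cos ((θ x - θ y) / 2) * ((δ x - δ y) / 2)) 0 := by
    intro x y
    have hlin : ∀ z, HasDerivAt (fun τ : ℝ => (θ + τ • δ) z) (δ z) 0 := by
      intro z
      simpa using ((hasDerivAt_id (0 : ℝ)).mul_const (δ z)).const_add (θ z)
    simpa using (((hlin x).sub (hlin y)).div_const 2).sin
  rw [← hdiff.lineDeriv_eq_fderiv]
  refine HasLineDerivAt.lineDeriv (HasDerivAt.congr_deriv
    (((hsin v s).mul (hsin w u)).div ((hsin v u).mul (hsin w s)) (by simpa using h)) ?_)
  have hD := left_ne_zero_of_mul h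
  have hs := right_ne_zero_of_mul h
  have f1 : δ v - δ u = (δ v - δ s) - (δ u - δ s) := by ring
  have f2 : δ w - δ u = (δ w - δ s) - (δ u - δ s) := by ring
  simp only [Pi.mul_apply, zero_smul, add_zero]
  have hu : sin ((θ u - θ s) / 2) = sin ((θ w - θ s) / 2) * cos ((θ w - θ u) / 2)
      - cos ((θ w - θ s) / 2) * sin ((θ w - θ u) / 2) := by
    rw [← sin_sub]; ring_nf
  have hu' : sin ((θ u - θ s) / 2) = sin ((θ v - θ s) / 2) * cos ((θ v - θ u) / 2)
      - cos ((θ v - θ s) / 2) * sin ((θ v - θ u) / 2) := by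
    rw [← sin_sub]; ring_nf
  have hwv : sin ((θ w - θ v) / 2) = sin ((θ w - θ u) / 2) * cos ((θ v - θ u) / 2)
      - cos ((θ w - θ u) / 2) * sin ((θ v - θ u) / 2) := by
    rw [← sin_sub]; ring_nf
  rw [f1, f2]
  generalize δ u - δ s = du
  generalize δ v - δ s = dv
  generalize δ w - δ s = dw
  field_simp
  linear_combination
    (-(sin ((θ v - θ s) / 2) * sin ((θ w - θ s) / 2) * du)) * hwv
      + (sin ((θ w - θ u) / 2) * sin ((θ w - θ s) / 2) * dv) * hu'
      - (sin ((θ v - θ s) / 2) * sin ((θ v - θ u) / 2) * dw) * hu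

theorem sum_mul_map_single {N : ℕ} (L : (Fin N → ℝ) →L[ℝ] ℝ) (δ : Fin N → ℝ) :
    ∑ j, δ j * L (Pi.single j 1) = L δ := by
  conv_rhs => rw [pi_eq_sum_univ' δ, map_sum]
  exact Finset.sum_congr rfl fun j _ => by simp [Pi.single]

open Real in
theorem kuramotoF_eq_of_unique_source {N : ℕ} {W α : Fin N → Fin N → ℝ} {ω : Fin N → ℝ} {σ : ℝ}
    {s x : Fin N} {z : ℂ} (hx : ∀ k, k ≠ s → W x k = 0)
    (hz : ((σ : ℂ) / 2) * (W x s : ℂ) * Complex.exp (-Complex.I * (α x s : ℂ)) = z)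
    (hω : ω x = ω s - 2 * z.im) (θ : Fin N → ℝ) :
    kuramotoF W α ω σ θ x - ω s = -4 * sin ((θ x - θ s) / 2) *
      (z.re * cos ((θ x - θ s) / 2) + z.im * sin ((θ x - θ s) / 2)) := by
  have hexp : ((σ : ℂ) / 2) * (W x s : ℂ) * Complex.exp (-Complex.I * (α x s : ℂ)) =
      (((σ / 2 * W x s * cos (α x s) : ℝ) : ℂ) + ((-(σ / 2 * W x s * sin (α x s)) : ℝ) : ℂ)
        * Complex.I) := by
    rw [show -Complex.I * (α x s : ℂ) = ((-α x s : ℝ) : ℂ) * Complex.I by push_cast; ring,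
      Complex.exp_mul_I, ← Complex.ofReal_cos, ← Complex.ofReal_sin, cos_neg, sin_neg]
    push_cast
    ring
  have hre : z.re = σ / 2 * W x s * cos (α x s) := by
    rw [← hz, hexp, ← Complex.mk_eq_add_mul_I]
  have him : z.im = -(σ / 2 * W x s * sin (α x s)) := by
    rw [← hz, hexp, ← Complex.mk_eq_add_mul_I]
  rw [kuramotoF, Finset.sum_eq_single s (fun k _ hk => by simp [hx k hk]) (by simp), hω, hre, him,
    show θ s - θ x - α x s = -(2 * ((θ x - θ s) / 2)) - α x s by ring, sin_sub, sin_neg, cos_neg,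
    sin_two_mul, cos_two_mul]
  linear_combination (-2 * σ * W x s * sin (α x s)) * sin_sq_add_cos_sq ((θ x - θ s) / 2)


open Real in
theorem fderiv_crossRatioTheta_apply_eq_weighted {N : ℕ} (s u v w : Fin N) (θ δ : Fin N → ℝ)
    (h : sin ((θ v - θ u) / 2) * sin ((θ w - θ s) / 2) ≠ 0) {p q eu ev ew : ℝ}
    (hu : δ u - δ s = eu * (-4 * sin ((θ u - θ s) / 2) *
      (p * cos ((θ u - θ s) / 2) + q * sin ((θ u - θ s) / 2))))
    (hv : δ v - δ s = ev * (-4 * sin ((θ v - θ s) / 2) *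
      (p * cos ((θ v - θ s) / 2) + q * sin ((θ v - θ s) / 2))))
    (hw : δ w - δ s = ew * (-4 * sin ((θ w - θ s) / 2) *
      (p * cos ((θ w - θ s) / 2) + q * sin ((θ w - θ s) / 2)))) :
    fderiv ℝ (crossRatioTheta s u v w) θ δ =
      weightedCrossRatioDeriv p q eu ev ew
        ((θ u - θ s) / 2) ((θ v - θ s) / 2) ((θ w - θ s) / 2) := by
  have hD := left_ne_zero_of_mul h
  have hs := right_ne_zero_of_mul h
  rw [fderiv_crossRatioTheta_apply s u v w θ δ h, hu, hv, hw, weightedCrossRatioDeriv,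
    show (θ v - θ s) / 2 - (θ u - θ s) / 2 = (θ v - θ u) / 2 by ring,
    show (θ w - θ s) / 2 - (θ u - θ s) / 2 = (θ w - θ u) / 2 by ring,
    show (θ w - θ s) / 2 - (θ v - θ s) / 2 = (θ w - θ v) / 2 by ring]
  field_simp
  ring

open Real in
theorem fderiv_weightedCrossRatioDeriv_apply {N : ℕ} (s u v w : Fin N) (θ δ : Fin N → ℝ)
    (h : sin ((θ v - θ u) / 2) * sin ((θ w - θ s) / 2) ≠ 0) (p q eu ev ew : ℝ) {a b : ℝ}
    (hu : δ u - δ s = -4 * sin ((θ u - θ s) / 2) *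
      (a * cos ((θ u - θ s) / 2) + b * sin ((θ u - θ s) / 2)))
    (hv : δ v - δ s = -4 * sin ((θ v - θ s) / 2) *
      (a * cos ((θ v - θ s) / 2) + b * sin ((θ v - θ s) / 2)))
    (hw : δ w - δ s = -4 * sin ((θ w - θ s) / 2) *
      (a * cos ((θ w - θ s) / 2) + b * sin ((θ w - θ s) / 2))) :
    fderiv ℝ (fun ψ : Fin N → ℝ => weightedCrossRatioDeriv p q eu ev ew
        ((ψ u - ψ s) / 2) ((ψ v - ψ s) / 2) ((ψ w - ψ s) / 2)) θ δ =
      4 * (p * b - q * a) * sin ((θ u - θ s) / 2) * sin ((θ v - θ s) / 2) /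
          (sin ((θ w - θ s) / 2) * sin ((θ v - θ u) / 2) ^ 2) *
        (ev * sin ((θ v - θ s) / 2) * sin ((θ w - θ u) / 2)
          - eu * sin ((θ u - θ s) / 2) * sin ((θ w - θ v) / 2)
          - ew * sin ((θ w - θ s) / 2) * sin ((θ v - θ u) / 2)) := by
  have hD := left_ne_zero_of_mul h
  have hs := right_ne_zero_of_mul h
  have evu : (θ v - θ s) / 2 - (θ u - θ s) / 2 = (θ v - θ u) / 2 := by ring
  have ewu : (θ w - θ s) / 2 - (θ u - θ s) / 2 = (θ w - θ u) / 2 := by ring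
  have ewv : (θ w - θ s) / 2 - (θ v - θ s) / 2 = (θ w - θ v) / 2 := by ring
  have hdiff : DifferentiableAt ℝ (fun ψ : Fin N → ℝ => weightedCrossRatioDeriv p q eu ev ew
      ((ψ u - ψ s) / 2) ((ψ v - ψ s) / 2) ((ψ w - ψ s) / 2)) θ := by
    unfold weightedCrossRatioDeriv
    have hden : sin ((θ w - θ s) / 2) * sin ((θ v - θ s) / 2 - (θ u - θ s) / 2) ^ 2 ≠ 0 := by
      rw [evu]
      exact mul_ne_zero hs (pow_ne_zero 2 hD)
    fun_prop (disch := assumption)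
  have hphase : ∀ x : Fin N, δ x - δ s = -4 * sin ((θ x - θ s) / 2) *
      (a * cos ((θ x - θ s) / 2) + b * sin ((θ x - θ s) / 2)) →
      HasDerivAt (fun τ : ℝ => ((θ + τ • δ) x - (θ + τ • δ) s) / 2)
        (-2 * sin (((θ + (0 : ℝ) • δ) x - (θ + (0 : ℝ) • δ) s) / 2) *
          (a * cos (((θ + (0 : ℝ) • δ) x - (θ + (0 : ℝ) • δ) s) / 2)
            + b * sin (((θ + (0 : ℝ) • δ) x - (θ + (0 : ℝ) • δ) s) / 2))) 0 := by
    intro x hx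
    have hlin : ∀ z, HasDerivAt (fun τ : ℝ => (θ + τ • δ) z) (δ z) 0 := by
      intro z
      simpa using ((hasDerivAt_id (0 : ℝ)).mul_const (δ z)).const_add (θ z)
    refine (((hlin x).sub (hlin s)).div_const 2).congr_deriv ?_
    rw [hx, zero_smul, add_zero]
    ring
  rw [← hdiff.lineDeriv_eq_fderiv]
  refine HasLineDerivAt.lineDeriv (HasDerivAt.congr_deriv
    (hasDerivAt_weightedCrossRatioDeriv p q eu ev ew a b 0 (hphase u hu) (hphase v hv)
      (hphase w hw) ?_ ?_) ?_)
  · simpa [evu] using hD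
  · simpa using hs
  · simp only [zero_smul, add_zero, evu, ewu, ewv]

/-- Theorem 3B (symmetry-generated constants of motion): if three vertices `u,v,w` receive a
unique incoming edge from the source `s` with identical complex weight `𝒜_s ≠ 0`, have natural
frequencies `ω_s − 2 Im(𝒜_s)`, and one or two of them belong to the subgraph `𝒲_η`, then the
cross-ratio `C_{suvw}` and its image `h = S_η[C_{suvw}]` under the symmetry generator are
functionally independent constants of motion. -/
theorem symmetry_generated_constants_B (N : ℕ) (hN : 4 ≤ N)
    (W α : Fin N → Fin N → ℝ) (ω : Fin N → ℝ) (σ : ℝ) (hσ : σ ≠ 0)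
    (hW : ∀ j, W j j = 0) (hα : ∀ j, α j j = 0)
    (hαbound : ∀ j k, |α j k| ≤ Real.pi / 2)
    (r : ℕ) (hr : 1 < r) (s : Fin N) (𝒲 : Fin r → Finset (Fin N))
    (hne : ∀ η', (𝒲 η').Nonempty)
    (hdisj : ∀ η' τ, η' ≠ τ → Disjoint (𝒲 η') (𝒲 τ))
    (hsnot : ∀ η', s ∉ 𝒲 η')
    (hcover : ∀ j : Fin N, j ≠ s → ∃ η', j ∈ 𝒲 η')
    (hsource : ∀ k, W s k = 0)
    (hnoedge : ∀ η' τ, η' ≠ τ → ∀ j ∈ 𝒲 η', ∀ k ∈ 𝒲 τ, W j k = 0)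
    (η : Fin r)
    (u v w : Fin N) (huv : u ≠ v) (huw : u ≠ w) (hvw : v ≠ w)
    (hus : u ≠ s) (hvs : v ≠ s) (hws : w ≠ s)
    (As : ℂ)
    (hB1a : ∀ x ∈ ({u, v, w} : Finset (Fin N)), ∀ k, k ≠ s → W x k = 0)
    (hB1b : As ≠ 0 ∧ ∀ x ∈ ({u, v, w} : Finset (Fin N)),
      ((σ : ℂ) / 2) * (W x s : ℂ) * Complex.exp (-Complex.I * (α x s : ℂ)) = As)
    (hB2 : ω u = ω s - 2 * As.im ∧ ω v = ω s - 2 * As.im ∧ ω w = ω s - 2 * As.im)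
    (hB3 : 1 ≤ (({u, v, w} : Finset (Fin N)) ∩ 𝒲 η).card ∧
      (({u, v, w} : Finset (Fin N)) ∩ 𝒲 η).card ≤ 2) :
    (∀ θ : Fin N → ℝ,
        Real.sin ((θ v - θ u) / 2) * Real.sin ((θ w - θ s) / 2) ≠ 0 →
        ∑ j, kuramotoF W α ω σ θ j *
          fderiv ℝ (crossRatioTheta s u v w) θ (Pi.single j 1) = 0) ∧
    (∀ θ : Fin N → ℝ,
        Real.sin ((θ v - θ u) / 2) * Real.sin ((θ w - θ s) / 2) ≠ 0 →
        ∑ j, kuramotoF W α ω σ θ j *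
          fderiv ℝ (fun θ' => ∑ k, kuramotoG W α ω σ (𝒲 η) (ω s) θ' k *
            fderiv ℝ (crossRatioTheta s u v w) θ' (Pi.single k 1)) θ (Pi.single j 1) = 0) ∧
    (∃ θ : Fin N → ℝ,
        Real.sin ((θ v - θ u) / 2) * Real.sin ((θ w - θ s) / 2) ≠ 0 ∧
        Matrix.rank (Matrix.of
          ![fun j => fderiv ℝ (crossRatioTheta s u v w) θ (Pi.single j 1),
            fun j => fderiv ℝ (fun θ' => ∑ k, kuramotoG W α ω σ (𝒲 η) (ω s) θ' k *
              fderiv ℝ (crossRatioTheta s u v w) θ' (Pi.single k 1)) θ (Pi.single j 1)]) = 2) := by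
  obtain ⟨hA0, hA⟩ := hB1b
  obtain ⟨hωu, hωv, hωw⟩ := hB2
  have hFu := kuramotoF_eq_of_unique_source (hB1a u (by simp)) (hA u (by simp)) hωu
  have hFv := kuramotoF_eq_of_unique_source (hB1a v (by simp)) (hA v (by simp)) hωv
  have hFw := kuramotoF_eq_of_unique_source (hB1a w (by simp)) (hA w (by simp)) hωw
  have hFs : ∀ θ, kuramotoF W α ω σ θ s = ω s := fun θ => by simp [kuramotoF, hsource]
  set e : Fin N → ℝ := fun x => if x ∈ 𝒲 η then 1 else 0 with he
  have hG : ∀ θ x, kuramotoG W α ω σ (𝒲 η) (ω s) θ x - kuramotoG W α ω σ (𝒲 η) (ω s) θ s =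
      e x * (kuramotoF W α ω σ θ x - ω s) := by
    intro θ x
    by_cases hx : x ∈ 𝒲 η <;> simp [kuramotoG, he, hsnot η, hx]
  have hh : ∀ θ : Fin N → ℝ,
      Real.sin ((θ v - θ u) / 2) * Real.sin ((θ w - θ s) / 2) ≠ 0 →
      fderiv ℝ (fun θ' => ∑ k, kuramotoG W α ω σ (𝒲 η) (ω s) θ' k *
        fderiv ℝ (crossRatioTheta s u v w) θ' (Pi.single k 1)) θ =
      fderiv ℝ (fun ψ : Fin N → ℝ => weightedCrossRatioDeriv As.re As.im (e u) (e v) (e w)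
        ((ψ u - ψ s) / 2) ((ψ v - ψ s) / 2) ((ψ w - ψ s) / 2)) θ := by
    intro θ hθ
    refine Filter.EventuallyEq.fderiv_eq ?_
    have hcont : Continuous fun ψ : Fin N → ℝ =>
        Real.sin ((ψ v - ψ u) / 2) * Real.sin ((ψ w - ψ s) / 2) := by fun_prop
    filter_upwards [hcont.continuousAt.eventually_ne hθ] with ψ hψ
    rw [sum_mul_map_single]
    exact fderiv_crossRatioTheta_apply_eq_weighted s u v w ψ _ hψ
      (by rw [hG, hFu]) (by rw [hG, hFv]) (by rw [hG, hFw])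
  refine ⟨fun θ hθ => ?_, fun θ hθ => ?_, ?_⟩
  · rw [sum_mul_map_single, fderiv_crossRatioTheta_apply_eq_weighted s u v w θ _ hθ
      (by rw [hFs, hFu, one_mul]) (by rw [hFs, hFv, one_mul]) (by rw [hFs, hFw, one_mul]),
      weightedCrossRatioDeriv_one]
  · rw [hh θ hθ, sum_mul_map_single, fderiv_weightedCrossRatioDeriv_apply s u v w θ _ hθ _ _ _ _ _
      (by rw [hFs, hFu]) (by rw [hFs, hFv]) (by rw [hFs, hFw])]
    ring
  · obtain ⟨θ, hθs, hθu, hθv, hθw⟩ : ∃ θ : Fin N → ℝ, θ s = 0 ∧ θ u = Real.pi / 2 ∧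
        θ v = Real.pi ∧ θ w = 3 * Real.pi / 2 := by
      refine ⟨fun j => if j = u then Real.pi / 2 else if j = v then Real.pi else
        if j = w then 3 * Real.pi / 2 else 0, ?_, ?_, ?_, ?_⟩ <;>
      simp [hus.symm, hvs.symm, hws.symm, huv.symm, huw.symm, hvw.symm]
    have hsu : Real.sin ((θ u - θ s) / 2) = √2 / 2 := by
      rw [hθu, hθs, ← Real.sin_pi_div_four]; ring_nf
    have hsv : Real.sin ((θ v - θ s) / 2) = 1 := by
      rw [hθv, hθs, sub_zero, Real.sin_pi_div_two]
    have hsw : Real.sin ((θ w - θ s) / 2) = √2 / 2 := by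
      rw [hθw, hθs, ← Real.sin_pi_div_four, ← Real.sin_pi_sub]; ring_nf
    have hsvu : Real.sin ((θ v - θ u) / 2) = √2 / 2 := by
      rw [hθu, hθv, ← Real.sin_pi_div_four]; ring_nf
    have hswv : Real.sin ((θ w - θ v) / 2) = √2 / 2 := by
      rw [hθw, hθv, ← Real.sin_pi_div_four]; ring_nf
    have hswu : Real.sin ((θ w - θ u) / 2) = 1 := by
      rw [hθw, hθu, ← Real.sin_pi_div_two]; ring_nf
    have hθ : Real.sin ((θ v - θ u) / 2) * Real.sin ((θ w - θ s) / 2) ≠ 0 := by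
      rw [hsvu, hsw]; positivity
    refine ⟨θ, hθ, ?_⟩
    rw [hh θ hθ]
    have hcoef : -(e u) + 2 * e v - e w ≠ 0 := by
      have hcard : ({u, v, w} : Finset (Fin N)).card = 3 := by simp [huv, huw, hvw]
      have hnone : ¬ (u ∉ 𝒲 η ∧ v ∉ 𝒲 η ∧ w ∉ 𝒲 η) := by
        rintro ⟨h1, h2, h3⟩
        have : ({u, v, w} : Finset (Fin N)) ∩ 𝒲 η = ∅ := by
          simp [Finset.insert_inter_of_notMem, Finset.singleton_inter_of_notMem, h1, h2, h3]
        simp [this] at hB3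
      have hall : ¬ (u ∈ 𝒲 η ∧ v ∈ 𝒲 η ∧ w ∈ 𝒲 η) := by
        rintro ⟨h1, h2, h3⟩
        have : ({u, v, w} : Finset (Fin N)) ∩ 𝒲 η = {u, v, w} := by
          simp [h1, h2, h3]
        rw [this] at hB3
        omega
      by_cases h1 : u ∈ 𝒲 η <;> by_cases h2 : v ∈ 𝒲 η <;> by_cases h3 : w ∈ 𝒲 η <;>
        simp [h1, h2, h3] at hnone hall <;> norm_num [he, h1, h2, h3]
    have hnorm : As.re * As.re + As.im * As.im ≠ 0 := by
      rw [← Complex.normSq_apply]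
      exact (Complex.normSq_pos.2 hA0).ne'
    set δ : Fin N → ℝ := fun j => -4 * Real.sin ((θ j - θ s) / 2) *
      (-As.im * Real.cos ((θ j - θ s) / 2) + As.re * Real.sin ((θ j - θ s) / 2)) with hδ
    have hδs : δ s = 0 := by simp [hδ]
    have hC_δ : fderiv ℝ (crossRatioTheta s u v w) θ δ = 0 := by
      rw [fderiv_crossRatioTheta_apply_eq_weighted s u v w θ δ hθ
        (by rw [hδs, sub_zero, one_mul]) (by rw [hδs, sub_zero, one_mul])
        (by rw [hδs, sub_zero, one_mul]), weightedCrossRatioDeriv_one]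
    have hh_δ : fderiv ℝ (fun ψ : Fin N → ℝ => weightedCrossRatioDeriv As.re As.im
        (e u) (e v) (e w) ((ψ u - ψ s) / 2) ((ψ v - ψ s) / 2) ((ψ w - ψ s) / 2)) θ δ ≠ 0 := by
      rw [fderiv_weightedCrossRatioDeriv_apply s u v w θ δ hθ _ _ _ _ _
        (by rw [hδs, sub_zero]) (by rw [hδs, sub_zero]) (by rw [hδs, sub_zero]),
        hsu, hsv, hsw, hsvu, hswv, hswu]
      refine mul_ne_zero (div_ne_zero (mul_ne_zero (mul_ne_zero (mul_ne_zero four_ne_zero ?_)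
        (by positivity)) one_ne_zero) (by positivity)) ?_
      · intro h0
        exact hnorm (by linear_combination h0)
      · intro h0
        have hsq : √2 * √2 = (2 : ℝ) := Real.mul_self_sqrt zero_le_two
        exact hcoef (by linear_combination 2 * h0 + (e u + e w) / 2 * hsq)
    have hC_w : fderiv ℝ (crossRatioTheta s u v w) θ (Pi.single w 1) ≠ 0 := by
      rw [fderiv_crossRatioTheta_apply s u v w θ _ hθ, hsu, hsv, hsw, hsvu, hswv, hswu]
      simp [huw, hvw, hws.symm]
    have hli : LinearIndependent ℝ (Matrix.of
        ![fun j => fderiv ℝ (crossRatioTheta s u v w) θ (Pi.single j 1),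
          fun j => fderiv ℝ (fun ψ : Fin N → ℝ => weightedCrossRatioDeriv As.re As.im
            (e u) (e v) (e w) ((ψ u - ψ s) / 2) ((ψ v - ψ s) / 2) ((ψ w - ψ s) / 2)) θ
            (Pi.single j 1)]).row := by
      refine LinearIndependent.pair_iff.2 fun x y hxy => ?_
      have hj : ∀ j, x * fderiv ℝ (crossRatioTheta s u v w) θ (Pi.single j 1) +
          y * fderiv ℝ (fun ψ : Fin N → ℝ => weightedCrossRatioDeriv As.re As.im
            (e u) (e v) (e w) ((ψ u - ψ s) / 2) ((ψ v - ψ s) / 2) ((ψ w - ψ s) / 2)) θ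
            (Pi.single j 1) = 0 := fun j => congrFun hxy j
      have hy : y = 0 := by
        have hsum := Finset.sum_eq_zero (s := Finset.univ)
          fun j _ => mul_eq_zero_of_right (δ j) (hj j)
        simp only [mul_add, mul_left_comm (δ _), Finset.sum_add_distrib, ← Finset.mul_sum,
          sum_mul_map_single] at hsum
        rw [hC_δ, mul_zero, zero_add] at hsum
        exact (mul_eq_zero.1 hsum).resolve_right hh_δ
      have hx := hj w
      rw [hy, zero_mul, add_zero] at hx
      exact ⟨(mul_eq_zero.1 hx).resolve_right hC_w, hy⟩
    simpa using hli.rank_matrix
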